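/- arXiv:1303.0969 — 2 statements merged into one kernel-verified Lean document; each statement's English description precedes it below -/
import Mathlib

section
/- Let α, ρ ∈ (0,1) with α irrational. Then R^α_ρ ∩ R'^α_ρ = {0, 1}, the set consisting of the two one-letter binary words. -/
open Set

noncomputable section

/-- Exchange of two intervals with parameter `α`, acting on `[0,1)`:
`T_α(x) = x + 1 - α` for `x ∈ [0,α)` and `T_α(x) = x - α` for `x ∈ [α,1)`. -/
def twoIE (α x : ℝ) : ℝ := if x < α then x + 1 - α else x - α

/-- The Sturmian word with slope `α` and intercept `ρ`:
`false` codes the letter 0 (i.e. `T_α^n(ρ) ∈ [0,α)`), `true` codes the letter 1. -/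
def sturmian (α ρ : ℝ) (n : ℕ) : Bool := if α ≤ (twoIE α)^[n] ρ then true else false

/-- The factor of length `n` of an infinite word `u` starting at position `i`. -/
def seg (u : ℕ → Bool) (i n : ℕ) : List Bool := (List.range n).map (fun j => u (i + j))

/-- The prefix of length `n` of `u`. -/
def wordPrefix (u : ℕ → Bool) (n : ℕ) : List Bool := seg u 0 n

/-- Return time of `x` to the set `I` under `twoIE α`:
the least `m ≥ 1` such that `T_α^m(x) ∈ I`. -/
def returnTime (α : ℝ) (I : Set ℝ) (x : ℝ) : ℕ :=
  sInf {m : ℕ | 0 < m ∧ (twoIE α)^[m] x ∈ I}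

/-- The `I`-itinerary of `x`: the prefix of length `returnTime α I x` of the
Sturmian word with slope `α` and intercept `x`. -/
def itin (α : ℝ) (I : Set ℝ) (x : ℝ) : List Bool :=
  wordPrefix (sturmian α x) (returnTime α I x)

/-- Two binary words are abelian equivalent if they have the same length and the
same number of occurrences of the letter 0 (coded by `false`). -/
def AbEquiv (w w' : List Bool) : Prop :=
  w.length = w'.length ∧ w.count false = w'.count false

/-- `w` is a factor of the infinite word `u`. -/
def IsFactor (u : ℕ → Bool) (w : List Bool) : Prop := ∃ i, seg u i w.length = w

/-- Positions of occurrences in `u` of factors abelian equivalent to `w`. -/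
def abOcc (u : ℕ → Bool) (w : List Bool) : Set ℕ :=
  {i | AbEquiv (seg u i w.length) w}

/-- The set of abelian return words to `w` in `u`: the words of `u` lying between
two consecutive occurrences of factors abelian equivalent to `w`. -/
def AR (u : ℕ → Bool) (w : List Bool) : Set (List Bool) :=
  {v | ∃ i j : ℕ, i ∈ abOcc u w ∧ j ∈ abOcc u w ∧ i < j ∧
        (∀ m, i < m → m < j → m ∉ abOcc u w) ∧ v = seg u i (j - i)}

/-- The set of abelian return words to all nonempty prefixes of `u`. -/
def APR (u : ℕ → Bool) : Set (List Bool) :=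
  ⋃ n ∈ {n : ℕ | 1 ≤ n}, AR u (wordPrefix u n)

/-- `S_β`: the set of `[0,β)`-itineraries under `twoIE α`. -/
def Sitin (α β : ℝ) : Set (List Bool) :=
  {w | ∃ x ∈ Ico (0:ℝ) β, itin α (Ico (0:ℝ) β) x = w}

/-- `R^α_ρ`: the union of the sets of `[0,β)`-itineraries over `ρ ≤ β < 1`. -/
def Rlight (α ρ : ℝ) : Set (List Bool) := ⋃ β ∈ Ico ρ 1, Sitin α β

/-- `R'^α_ρ`: the union of the sets of `[γ,1)`-itineraries over `0 < γ ≤ ρ`. -/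
def Rheavy (α ρ : ℝ) : Set (List Bool) :=
  ⋃ γ ∈ Ioc (0:ℝ) ρ, {w | ∃ x ∈ Ico γ 1, itin α (Ico γ 1) x = w}

/-- The Gauss map `x ↦ {1/x}`. -/
def gaussMap (x : ℝ) : ℝ := Int.fract x⁻¹

/-- The `k`-th partial quotient `a_k` (for `k ≥ 1`) of the continued fraction
expansion `α = [0; a_1, a_2, …]` of `α ∈ (0,1)`. -/
def cfa (α : ℝ) (k : ℕ) : ℕ := ⌊(gaussMap^[k - 1] α)⁻¹⌋₊

/-- `cfPQ α n = (p_{n-1}, q_{n-1})`, numerators and denominators of the convergents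
of `α`: `p_{-1} = 1`, `q_{-1} = 0`, `p_0 = 0`, `q_0 = 1`,
`p_k = a_k p_{k-1} + p_{k-2}`, `q_k = a_k q_{k-1} + q_{k-2}`. -/
def cfPQ (α : ℝ) : ℕ → ℤ × ℤ
  | 0 => (1, 0)
  | 1 => (0, 1)
  | (k + 2) => ((cfa α (k + 1) : ℤ) * (cfPQ α (k + 1)).1 + (cfPQ α k).1,
                (cfa α (k + 1) : ℤ) * (cfPQ α (k + 1)).2 + (cfPQ α k).2)

/-- `δ_{k,s} = |(s-1)(p_k - α q_k) + p_{k-1} - α q_{k-1}|` for `k ≥ 0`, `1 ≤ s ≤ a_{k+1}`. -/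
def cfDelta (α : ℝ) (k s : ℕ) : ℝ :=
  |((s : ℝ) - 1) * (((cfPQ α (k + 1)).1 : ℝ) - α * ((cfPQ α (k + 1)).2 : ℝ)) +
      (((cfPQ α k).1 : ℝ) - α * ((cfPQ α k).2 : ℝ))|

end

theorem twoIE_of_lt {α x : ℝ} (h : x < α) : twoIE α x = x + 1 - α := if_pos h

theorem twoIE_of_le {α x : ℝ} (h : α ≤ x) : twoIE α x = x - α := if_neg h.not_gt

theorem twoIE_mem_Ico {α x : ℝ} (hα : α ∈ Ioo (0:ℝ) 1) (hx : x ∈ Ico (0:ℝ) 1) :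
    twoIE α x ∈ Ico (0:ℝ) 1 := by
  obtain ⟨h0, h1⟩ := hα
  obtain ⟨hx0, hx1⟩ := hx
  rcases lt_or_ge x α with h | h
  · rw [twoIE_of_lt h]; constructor <;> linarith
  · rw [twoIE_of_le h]; constructor <;> linarith

theorem coe_twoIE (α x : ℝ) :
    ((twoIE α x : ℝ) : AddCircle (1:ℝ)) = (x : AddCircle (1:ℝ)) + ((-α : ℝ) : AddCircle (1:ℝ)) := by
  rw [← AddCircle.coe_add]
  rcases lt_or_ge x α with h | h
  · rw [twoIE_of_lt h, show x + 1 - α = (x + -α) + 1 by ring, AddCircle.coe_add,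
      AddCircle.coe_period, add_zero]
  · rw [twoIE_of_le h, sub_eq_add_neg]

theorem iterate_twoIE_mem_Ico {α x : ℝ} (hα : α ∈ Ioo (0:ℝ) 1) (hx : x ∈ Ico (0:ℝ) 1) (n : ℕ) :
    (twoIE α)^[n] x ∈ Ico (0:ℝ) 1 :=
  MapsTo.iterate (fun _ h => twoIE_mem_Ico hα h) n hx

theorem coe_iterate_twoIE (α x : ℝ) (n : ℕ) :
    (((twoIE α)^[n] x : ℝ) : AddCircle (1:ℝ)) =
      (x : AddCircle (1:ℝ)) + n • ((-α : ℝ) : AddCircle (1:ℝ)) := by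
  induction n with
  | zero => simp
  | succ n ih => rw [Function.iterate_succ_apply', coe_twoIE, ih, succ_nsmul, add_assoc]

/-- Forward orbits of an irrational rotation visit every interval `(0,β)`. -/
theorem exists_iterate_twoIE_mem {α β x : ℝ} (hα : α ∈ Ioo (0:ℝ) 1) (hirr : Irrational α)
    (hβ : β ∈ Ioo (0:ℝ) 1) (hx : x ∈ Ico (0:ℝ) 1) :
    ∃ n : ℕ, (twoIE α)^[n] x ∈ Ico (0:ℝ) β := by
  have hd : DenseRange (fun n : ℕ => n • ((-α : ℝ) : AddCircle (1:ℝ))) := by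
    rw [← denseRange_zsmul_iff_nsmul, AddCircle.denseRange_zsmul_coe_iff]
    simpa using hirr
  have hopen : IsOpen ((fun t : ℝ => (t : AddCircle (1:ℝ))) '' Ioo 0 β) :=
    QuotientAddGroup.isOpenMap_coe _ isOpen_Ioo
  obtain ⟨n, t, ht, htn⟩ := hd.exists_mem_open
    (hopen.preimage (continuous_const_add (x : AddCircle (1:ℝ))))
    ⟨((β / 2 - x : ℝ) : AddCircle (1:ℝ)), β / 2,
      ⟨by linarith [hβ.1], by linarith [hβ.1]⟩, by simp⟩
  have hmem := iterate_twoIE_mem_Ico hα hx n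
  have heq : (t : AddCircle (1:ℝ)) = (((twoIE α)^[n] x : ℝ) : AddCircle (1:ℝ)) :=
    htn.trans (coe_iterate_twoIE α x n).symm
  have : Fact ((0:ℝ) < 1) := ⟨one_pos⟩
  rw [AddCircle.coe_eq_coe_iff_of_mem_Ico (a := 0) ⟨ht.1.le, by linarith [ht.2, hβ.2]⟩
    (by simpa using hmem)] at heq
  exact ⟨n, heq ▸ ⟨ht.1.le, ht.2⟩⟩

theorem returnTime_Ico_pos {α β x : ℝ} (hα : α ∈ Ioo (0:ℝ) 1) (hirr : Irrational α)
    (hβ : β ∈ Ioo (0:ℝ) 1) (hx : x ∈ Ico (0:ℝ) 1) :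
    0 < returnTime α (Ico 0 β) x := by
  obtain ⟨n, hn⟩ := exists_iterate_twoIE_mem hα hirr hβ (twoIE_mem_Ico hα hx)
  have hne : {m : ℕ | 0 < m ∧ (twoIE α)^[m] x ∈ Ico (0:ℝ) β}.Nonempty :=
    ⟨n + 1, n.succ_pos, hn⟩
  exact (Nat.sInf_mem hne).1

theorem returnTime_eq_one {α x : ℝ} {I : Set ℝ} (h : twoIE α x ∈ I) : returnTime α I x = 1 := by
  have hmem : 1 ∈ {m : ℕ | 0 < m ∧ (twoIE α)^[m] x ∈ I} := ⟨one_pos, h⟩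
  exact le_antisymm (Nat.sInf_le hmem) (Nat.sInf_mem ⟨1, hmem⟩).1

theorem itin_eq_singleton {α x : ℝ} {I : Set ℝ} (h : twoIE α x ∈ I) :
    itin α I x = [decide (α ≤ x)] := by
  simp [itin, returnTime_eq_one h, wordPrefix, seg, sturmian]
  congr

theorem head?_itin {α x : ℝ} {I : Set ℝ} (h : 0 < returnTime α I x) :
    (itin α I x).head? = some (decide (α ≤ x)) := by
  obtain ⟨n, hn⟩ := Nat.exists_eq_succ_of_ne_zero h.ne'
  simp [itin, hn, wordPrefix, seg, sturmian, List.range_succ_eq_map]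
  congr

theorem itin_Ico_left {α β x : ℝ} (hx : x ∈ Ico 0 β) (hα : 0 < α) (h : α ≤ x) :
    itin α (Ico 0 β) x = [true] := by
  rw [itin_eq_singleton, decide_eq_true h]
  rw [twoIE_of_le h]
  exact ⟨by linarith, by linarith [hx.2]⟩

theorem itin_Ico_right {α γ x : ℝ} (hx : x ∈ Ico γ 1) (hα : α < 1) (h : x < α) :
    itin α (Ico γ 1) x = [false] := by
  rw [itin_eq_singleton, decide_eq_false h.not_ge]
  rw [twoIE_of_lt h]
  exact ⟨by linarith [hx.1], by linarith⟩

theorem singleton_mem_Rlight {α ρ : ℝ} (hα : α ∈ Ioo (0:ℝ) 1) (hρ : ρ < 1) (b : Bool) :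
    [b] ∈ Rlight α ρ := by
  obtain ⟨h0, h1⟩ := hα
  obtain ⟨β, hβ, hβ1⟩ := exists_between
    (show max ρ (max α (1 - α)) < 1 from max_lt hρ (max_lt h1 (by linarith)))
  simp only [max_lt_iff] at hβ
  obtain ⟨hρβ, hαβ, hαβ'⟩ := hβ
  refine mem_iUnion₂.2 ⟨β, ⟨hρβ.le, hβ1⟩, ?_⟩
  cases b with
  | false =>
    refine ⟨0, ⟨le_rfl, by linarith⟩, ?_⟩
    rw [itin_eq_singleton, decide_eq_false h0.not_ge]
    rw [twoIE_of_lt h0]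
    exact ⟨by linarith, by linarith⟩
  | true => exact ⟨α, ⟨h0.le, hαβ⟩, itin_Ico_left ⟨h0.le, hαβ⟩ h0 le_rfl⟩

theorem singleton_mem_Rheavy {α ρ : ℝ} (hα : α ∈ Ioo (0:ℝ) 1) (hρ : 0 < ρ) (b : Bool) :
    [b] ∈ Rheavy α ρ := by
  obtain ⟨h0, h1⟩ := hα
  obtain ⟨γ, hγ0, hγ⟩ := exists_between
    (show 0 < min ρ (min α (1 - α)) from lt_min hρ (lt_min h0 (by linarith)))
  simp only [lt_min_iff] at hγ
  obtain ⟨hγρ, hγα, hγα'⟩ := hγ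
  refine mem_iUnion₂.2 ⟨γ, ⟨hγ0, hγρ.le⟩, ?_⟩
  have hγ1 : γ < 1 := by linarith
  cases b with
  | false => exact ⟨γ, ⟨le_rfl, hγ1⟩, itin_Ico_right ⟨le_rfl, hγ1⟩ h1 hγα⟩
  | true =>
    have hle : α ≤ γ + α := by linarith
    refine ⟨γ + α, ⟨by linarith, by linarith⟩, ?_⟩
    rw [itin_eq_singleton, decide_eq_true hle]
    rw [twoIE_of_le hle]
    exact ⟨by linarith, by linarith⟩

/-- `R^α_ρ ∩ R'^α_ρ = {0, 1}`. -/
theorem Rlight_inter_Rheavy (α ρ : ℝ) (hα : α ∈ Set.Ioo (0:ℝ) 1)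
    (hirr : Irrational α) (hρ : ρ ∈ Set.Ioo (0:ℝ) 1) :
    Rlight α ρ ∩ Rheavy α ρ = ({[false], [true]} : Set (List Bool)) := by
  ext w
  simp only [mem_inter_iff, mem_insert_iff, mem_singleton_iff]
  constructor
  · rintro ⟨hl, hh⟩
    obtain ⟨β, hβ, x, hx, hxw⟩ := mem_iUnion₂.1 hl
    obtain ⟨γ, hγ, y, hy, hyw⟩ := mem_iUnion₂.1 hh
    rcases le_or_gt α x with hαx | hxα
    · exact .inr (hxw.symm.trans (itin_Ico_left hx hα.1 hαx))
    rcases lt_or_ge y α with hyα | hαy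
    · exact .inl (hyw.symm.trans (itin_Ico_right hy hα.2 hyα))
    have hx_head : w.head? = some false := by
      rw [← hxw, head?_itin (returnTime_Ico_pos hα hirr ⟨hρ.1.trans_le hβ.1, hβ.2⟩
        ⟨hx.1, hx.2.trans hβ.2⟩), decide_eq_false hxα.not_ge]
    have hw : w ≠ [] := by rintro rfl; simp at hx_head
    have hy_pos : 0 < returnTime α (Ico γ 1) y := by
      refine Nat.pos_of_ne_zero fun h => hw ?_
      simp [← hyw, itin, h, wordPrefix, seg]
    have hy_head := head?_itin hy_pos
    rw [hyw, hx_head, decide_eq_true hαy] at hy_head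
    simp at hy_head
  · rintro (rfl | rfl) <;>
      exact ⟨singleton_mem_Rlight hα hρ.2 _, singleton_mem_Rheavy hα hρ.1 _⟩
end

section
/- Let α, ρ ∈ (0,1) with α = [0; a_1, a_2, …] irrational and a_1 ≥ 2 (equivalently α < 1/2), and let u = u_{α,ρ}. If ρ ∈ (α, 1−α), then the cardinality of APR_u is either a_1 + 3 or a_1 + 4. -/
open Set

/-- The forward orbit of an irrational rotation of `ℝ / ℤ` visits every interval at a positive
time. -/
lemma exists_fract_add_mul_mem_Ioo {θ : ℝ} (hθ : Irrational θ) (r : ℝ) {a b : ℝ}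
    (ha : 0 ≤ a) (hab : a < b) (hb : b ≤ 1) :
    ∃ n : ℕ, 1 ≤ n ∧ Int.fract (r + n * θ) ∈ Ioo a b := by
  have hd : DenseRange (fun n : ℕ => n • (θ : AddCircle (1 : ℝ))) :=
    denseRange_zsmul_iff_nsmul.1 (AddCircle.denseRange_zsmul_coe_iff.2 (by simpa using hθ))
  have hopen : IsOpen ((QuotientAddGroup.mk : ℝ → AddCircle (1 : ℝ)) ''
      Ioo (a - (r + θ)) (b - (r + θ))) :=
    QuotientAddGroup.isOpenMap_coe _ isOpen_Ioo
  obtain ⟨n, y, hy, hyn⟩ := hd.exists_mem_open hopen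
    ((nonempty_Ioo.2 (by linarith)).image _)
  have hyn' : ((y - n * θ : ℝ) : AddCircle (1 : ℝ)) = 0 := by
    rw [AddCircle.coe_sub, ← nsmul_eq_mul, AddCircle.coe_nsmul, sub_eq_zero]
    exact hyn
  obtain ⟨m, hm⟩ := (AddCircle.coe_eq_zero_iff _).1 hyn'
  rw [zsmul_one] at hm
  obtain ⟨hy0, hy1⟩ := hy
  refine ⟨n + 1, by omega, ?_⟩
  have hfract : Int.fract (r + (n + 1 : ℕ) * θ) = r + θ + y := by
    rw [Int.fract_eq_iff]
    refine ⟨by linarith, by linarith, -m, ?_⟩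
    push_cast
    linarith
  rw [hfract]
  exact ⟨by linarith, by linarith⟩

section Seg

variable (u : ℕ → Bool) (i n : ℕ)

lemma seg_succ : seg u i (n + 1) = seg u i n ++ [u (i + n)] := by
  simp [seg, List.range_succ]

lemma seg_succ' : seg u i (n + 1) = u i :: seg u (i + 1) n := by
  simp [seg, List.range_succ_eq_map, Function.comp_def, add_assoc, add_comm 1]

@[simp] lemma length_seg : (seg u i n).length = n := by simp [seg]

lemma seg_eq_replicate {b : Bool} (h : ∀ m < n, u (i + m) = b) :
    seg u i n = List.replicate n b := by
  rw [List.eq_replicate_iff]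
  simpa [seg] using h

end Seg

section Orbit

variable {α ρ : ℝ}

lemma orbit_mem_Ico (hα : α ∈ Ioo (0 : ℝ) 1) (hρ : ρ ∈ Ioo (0 : ℝ) 1) (i : ℕ) :
    (twoIE α)^[i] ρ ∈ Ico (0 : ℝ) 1 := by
  induction i with
  | zero => exact ⟨hρ.1.le, hρ.2⟩
  | succ i ih =>
    rw [Function.iterate_succ_apply', twoIE]
    obtain ⟨h0, h1⟩ := ih
    obtain ⟨hα0, hα1⟩ := hα
    split_ifs <;> constructor <;> linarith

lemma orbit_succ_of_lt {i : ℕ} (h : (twoIE α)^[i] ρ < α) :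
    (twoIE α)^[i + 1] ρ = (twoIE α)^[i] ρ + 1 - α := by
  rw [Function.iterate_succ_apply', twoIE, if_pos h]

lemma orbit_succ_of_le {i : ℕ} (h : α ≤ (twoIE α)^[i] ρ) :
    (twoIE α)^[i + 1] ρ = (twoIE α)^[i] ρ - α := by
  rw [Function.iterate_succ_apply', twoIE, if_neg h.not_gt]

lemma orbit_add_of_le {i t : ℕ} (h : ∀ m < t, α ≤ (twoIE α)^[i + m] ρ) :
    (twoIE α)^[i + t] ρ = (twoIE α)^[i] ρ - t * α := by
  induction t with
  | zero => simp
  | succ t ih =>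
    rw [← add_assoc, orbit_succ_of_le (h t t.lt_succ_self), ih fun m hm => h m (by omega)]
    push_cast
    ring

lemma orbit_add_of_mul_le {i t : ℕ} (hα : 0 < α) (h : t * α ≤ (twoIE α)^[i] ρ) :
    (twoIE α)^[i + t] ρ = (twoIE α)^[i] ρ - t * α := by
  induction t with
  | zero => simp
  | succ t ih =>
    push_cast at h
    have := ih (by linarith)
    rw [← add_assoc, orbit_succ_of_le (by rw [this]; linarith), this]
    push_cast
    ring

lemma sturmian_of_lt {i : ℕ} (h : (twoIE α)^[i] ρ < α) : sturmian α ρ i = false := by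
  simp [sturmian, h]

lemma sturmian_of_le {i : ℕ} (h : α ≤ (twoIE α)^[i] ρ) : sturmian α ρ i = true := by
  simp [sturmian, h]

lemma count_false_seg (i n : ℕ) :
    ((seg (sturmian α ρ) i n).count false : ℝ) =
      (twoIE α)^[i + n] ρ - (twoIE α)^[i] ρ + n * α := by
  induction n with
  | zero => simp [seg]
  | succ n ih =>
    rw [seg_succ, List.count_append, Nat.cast_add, ih, ← add_assoc]
    rcases lt_or_ge ((twoIE α)^[i + n] ρ) α with h | h
    · rw [orbit_succ_of_lt h, sturmian_of_lt h]
      simp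
      ring
    · rw [orbit_succ_of_le h, sturmian_of_le h]
      simp
      ring

lemma orbit_eq_fract (hα : α ∈ Ioo (0 : ℝ) 1) (hρ : ρ ∈ Ioo (0 : ℝ) 1) (i : ℕ) :
    (twoIE α)^[i] ρ = Int.fract (ρ + i * (-α)) := by
  obtain ⟨h0, h1⟩ := orbit_mem_Ico hα hρ i
  have h := count_false_seg (α := α) (ρ := ρ) 0 i
  rw [eq_comm, Int.fract_eq_iff]
  refine ⟨h0, h1, -((seg (sturmian α ρ) 0 i).count false : ℤ), ?_⟩
  push_cast
  rw [h]
  simp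
  ring

lemma count_false_seg_eq (hα : α ∈ Ioo (0 : ℝ) 1) (hρ : ρ ∈ Ioo (0 : ℝ) 1) (i n : ℕ) :
    ((seg (sturmian α ρ) i n).count false : ℤ) =
      ⌊n * α⌋ + if (twoIE α)^[i] ρ < Int.fract (n * α) then 1 else 0 := by
  obtain ⟨h0, h1⟩ := orbit_mem_Ico hα hρ i
  obtain ⟨h2, h3⟩ := orbit_mem_Ico hα hρ (i + n)
  have h := count_false_seg (α := α) (ρ := ρ) i n
  have hf := Int.floor_add_fract (n * α)
  have hf0 := Int.fract_nonneg (n * α)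
  have hf1 := Int.fract_lt_one (n * α)
  generalize Int.fract (n * α) = c at *
  generalize ⌊n * α⌋ = z at *
  generalize (seg (sturmian α ρ) i n).count false = k at *
  rw [← sub_eq_iff_eq_add']
  split_ifs with hc
  · have h4 : (0 : ℝ) < ((k - z : ℤ) : ℝ) := by push_cast; linarith
    have h5 : ((k - z : ℤ) : ℝ) < 2 := by push_cast; linarith
    norm_cast at h4 h5
    omega
  · have h4 : (-1 : ℝ) < ((k - z : ℤ) : ℝ) := by push_cast; linarith
    have h5 : ((k - z : ℤ) : ℝ) < 1 := by push_cast; linarith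
    norm_cast at h4 h5
    omega

/-- Abelian occurrences of a prefix are visits of the orbit to `[0, {nα})` or `[{nα}, 1)`,
whichever contains `ρ`. -/
lemma mem_abOcc_iff (hα : α ∈ Ioo (0 : ℝ) 1) (hρ : ρ ∈ Ioo (0 : ℝ) 1) (i n : ℕ) :
    i ∈ abOcc (sturmian α ρ) (wordPrefix (sturmian α ρ) n) ↔
      ((twoIE α)^[i] ρ < Int.fract (n * α) ↔ ρ < Int.fract (n * α)) := by
  have h1 := count_false_seg_eq hα hρ i n
  have h2 := count_false_seg_eq hα hρ 0 n
  simp only [abOcc, AbEquiv, wordPrefix, length_seg, mem_ofPred_eq, true_and]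
  rw [← Nat.cast_inj (R := ℤ), h1, h2]
  by_cases h3 : (twoIE α)^[i] ρ < Int.fract (n * α) <;>
    by_cases h4 : ρ < Int.fract (n * α) <;> simp [h3, h4]

lemma mem_abOcc_iff_of_lt (hα : α ∈ Ioo (0 : ℝ) 1) (hρ : ρ ∈ Ioo (0 : ℝ) 1) {i n : ℕ}
    (h : ρ < Int.fract (n * α)) :
    i ∈ abOcc (sturmian α ρ) (wordPrefix (sturmian α ρ) n) ↔
      (twoIE α)^[i] ρ < Int.fract (n * α) := by
  simp [mem_abOcc_iff hα hρ, h]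

lemma mem_abOcc_iff_of_le (hα : α ∈ Ioo (0 : ℝ) 1) (hρ : ρ ∈ Ioo (0 : ℝ) 1) {i n : ℕ}
    (h : Int.fract (n * α) ≤ ρ) :
    i ∈ abOcc (sturmian α ρ) (wordPrefix (sturmian α ρ) n) ↔
      Int.fract (n * α) ≤ (twoIE α)^[i] ρ := by
  simp [mem_abOcc_iff hα hρ, h.not_gt]

lemma exists_fract_mem (hirr : Irrational α) {a b : ℝ} (ha : 0 ≤ a) (hab : a < b) (hb : b ≤ 1) :
    ∃ n : ℕ, 1 ≤ n ∧ Int.fract (n * α) ∈ Ioo a b := by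
  simpa using exists_fract_add_mul_mem_Ioo hirr 0 ha hab hb

lemma exists_orbit_mem (hα : α ∈ Ioo (0 : ℝ) 1) (hρ : ρ ∈ Ioo (0 : ℝ) 1) (hirr : Irrational α)
    {a b : ℝ} (ha : 0 ≤ a) (hab : a < b) (hb : b ≤ 1) :
    ∃ i : ℕ, (twoIE α)^[i] ρ ∈ Ioo a b := by
  obtain ⟨i, -, hi⟩ := exists_fract_add_mul_mem_Ioo hirr.neg ρ ha hab hb
  exact ⟨i, by rwa [orbit_eq_fract hα hρ]⟩

end Orbit

section AbelianReturns

variable {α ρ : ℝ}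

/-- Abelian returns to a prefix with `ρ < {nα}`. -/
lemma mem_of_mem_AR_of_lt (hα : α ∈ Ioo (0 : ℝ) 1) (hρ : ρ ∈ Ioo (0 : ℝ) 1) (hαρ : α < ρ)
    {n : ℕ} (hn : ρ < Int.fract (n * α)) {v : List Bool}
    (hv : v ∈ AR (sturmian α ρ) (wordPrefix (sturmian α ρ) n)) :
    v = [true] ∨ v = [false] ∨
      ∃ s : ℕ, s * α < 1 - ρ ∧ v = false :: List.replicate (s + 1) true := by
  obtain ⟨i, j, hi, hj, hij, hm, rfl⟩ := hv
  simp only [mem_abOcc_iff_of_lt hα hρ hn] at hi hj hm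
  rcases lt_or_ge ((twoIE α)^[i] ρ) α with h | h
  · right
    obtain ⟨t, rfl⟩ := Nat.exists_eq_add_of_lt hij
    have hx : ∀ m < t, Int.fract (n * α) ≤ (twoIE α)^[i + 1 + m] ρ := fun m hmt =>
      not_lt.1 (hm _ (by omega) (by omega))
    have hx' : ∀ m < t, α ≤ (twoIE α)^[i + 1 + m] ρ := fun m hmt => by linarith [hx m hmt]
    rw [show i + t + 1 - i = t + 1 by omega, seg_succ', sturmian_of_lt h,
      seg_eq_replicate _ _ _ fun m hmt => sturmian_of_le (hx' m hmt)]
    rcases t with _ | s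
    · simp
    · refine Or.inr ⟨s, ?_, rfl⟩
      have h1 := orbit_add_of_le fun m (hms : m < s) => hx' m (by omega)
      have h2 := hx s s.lt_succ_self
      rw [orbit_succ_of_lt h] at h1
      linarith
  · left
    have : j = i + 1 := by
      by_contra hne
      refine hm (i + 1) (by omega) (by omega) ?_
      rw [orbit_succ_of_le h]
      linarith [hα.1]
    subst this
    simp [seg, sturmian_of_le h]

/-- Abelian returns to a prefix with `{nα} ≤ ρ`. -/
lemma mem_of_mem_AR_of_le (hα : α ∈ Ioo (0 : ℝ) 1) (hρ : ρ ∈ Ioo (0 : ℝ) 1) (hαρ : ρ < 1 - α)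
    {n : ℕ} (hn : Int.fract (n * α) ≤ ρ) {v : List Bool}
    (hv : v ∈ AR (sturmian α ρ) (wordPrefix (sturmian α ρ) n)) :
    v = [true] ∨ v = [false] ∨
      ∃ s : ℕ, s * α < ρ ∧ v = List.replicate (s + 1) true ++ [false] := by
  obtain ⟨i, j, hi, hj, hij, hm, rfl⟩ := hv
  simp only [mem_abOcc_iff_of_le hα hρ hn] at hi hj hm
  obtain ⟨t, rfl⟩ := Nat.exists_eq_add_of_lt hij
  rw [show i + t + 1 - i = t + 1 by omega]
  have hx : ∀ m < t, α ≤ (twoIE α)^[i + m] ρ := by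
    intro m hmt
    by_contra! h
    refine hm (i + m + 1) (by omega) (by omega) ?_
    rw [orbit_succ_of_lt h]
    linarith [(orbit_mem_Ico hα hρ (i + m)).1]
  rw [seg_succ, seg_eq_replicate _ _ _ fun m hmt => sturmian_of_le (hx m hmt)]
  rcases t with _ | s
  · cases sturmian α ρ (i + 0) <;> simp
  · have h1 : (twoIE α)^[i + (s + 1)] ρ < Int.fract (n * α) :=
      not_le.1 (hm _ (by omega) (by omega))
    have h2 : (twoIE α)^[i + (s + 1)] ρ < α := by
      by_contra! h
      have := orbit_succ_of_le h
      rw [this] at hj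
      linarith [hα.1]
    refine Or.inr (Or.inr ⟨s, ?_, by rw [sturmian_of_lt h2]⟩)
    have h3 := orbit_add_of_le hx
    have h4 : (twoIE α)^[i + 1] ρ < Int.fract (n * α) :=
      not_le.1 (hm _ (by omega) (by omega))
    rw [orbit_succ_of_le (hx 0 s.succ_pos)] at h4
    have h5 := (orbit_mem_Ico hα hρ (i + (s + 1))).1
    simp only [add_zero] at h4
    push_cast at h3
    linarith

lemma mem_APR_of_mem_AR {u : ℕ → Bool} {n : ℕ} (hn : 1 ≤ n) {v : List Bool}
    (hv : v ∈ AR u (wordPrefix u n)) : v ∈ APR u :=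
  mem_iUnion₂.2 ⟨n, hn, hv⟩

lemma true_mem_APR (hα : α ∈ Ioo (0 : ℝ) 1) (hρ : ρ ∈ Ioo (0 : ℝ) 1) (hirr : Irrational α)
    (hαρ : α < ρ) : [true] ∈ APR (sturmian α ρ) := by
  obtain ⟨n, hn1, hn, -⟩ := exists_fract_mem hirr hρ.1.le hρ.2 le_rfl
  obtain ⟨i, hi, hi'⟩ := exists_orbit_mem hα hρ hirr hα.1.le hαρ hρ.2.le
  refine mem_APR_of_mem_AR hn1 ⟨i, i + 1, ?_, ?_, by omega, by omega, ?_⟩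
  · rw [mem_abOcc_iff_of_lt hα hρ hn]
    linarith
  · rw [mem_abOcc_iff_of_lt hα hρ hn, orbit_succ_of_le hi.le]
    linarith [hα.1]
  · simp [seg, sturmian_of_le hi.le]

lemma false_mem_APR (hα : α ∈ Ioo (0 : ℝ) 1) (hρ : ρ ∈ Ioo (0 : ℝ) 1) (hirr : Irrational α)
    (hαρ : α < ρ) (hρα : ρ < 1 - α) : [false] ∈ APR (sturmian α ρ) := by
  obtain ⟨hα0, hα1⟩ := id hα
  obtain ⟨n, hn1, hn, hn'⟩ :=
    exists_fract_mem hirr (a := 1 - α) (b := 1) (by linarith) (by linarith) le_rfl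
  obtain ⟨i, hi, hi'⟩ := exists_orbit_mem hα hρ hirr (a := 0) (b := Int.fract (n * α) - 1 + α)
    le_rfl (by linarith) (by linarith)
  refine mem_APR_of_mem_AR hn1 ⟨i, i + 1, ?_, ?_, by omega, by omega, ?_⟩
  · rw [mem_abOcc_iff_of_lt hα hρ (by linarith)]
    linarith
  · rw [mem_abOcc_iff_of_lt hα hρ (by linarith), orbit_succ_of_lt (by linarith)]
    linarith
  · simp [seg, sturmian_of_lt (show (twoIE α)^[i] ρ < α by linarith)]

lemma false_cons_replicate_mem_APR (hα : α ∈ Ioo (0 : ℝ) 1) (hρ : ρ ∈ Ioo (0 : ℝ) 1)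
    (hirr : Irrational α) (hαρ : α < ρ) {s : ℕ} (hs : s * α < 1 - ρ) :
    false :: List.replicate (s + 1) true ∈ APR (sturmian α ρ) := by
  obtain ⟨hα0, hα1⟩ := id hα
  have hsα : 0 ≤ s * α := by positivity
  obtain ⟨n, hn1, hn, hn'⟩ := exists_fract_mem hirr
    (a := max ρ (1 - (s + 1) * α)) (b := 1 - s * α) (le_max_of_le_left hρ.1.le)
    (max_lt (by linarith) (by linarith)) (by linarith)
  obtain ⟨hn, hn2⟩ := max_lt_iff.1 hn
  obtain ⟨i, hi, hi'⟩ := exists_orbit_mem hα hρ hirr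
    (a := Int.fract (n * α) - 1 + (s + 1) * α) (b := α) (by linarith) (by linarith) hα1.le
  have h1 := orbit_succ_of_lt hi'
  have h2 : ∀ m ≤ s, (twoIE α)^[i + 1 + m] ρ = (twoIE α)^[i] ρ + 1 - α - m * α ∧
      Int.fract (n * α) < (twoIE α)^[i + 1 + m] ρ := by
    intro m hms
    have h3 : (m : ℝ) * α ≤ s * α := by gcongr
    have h4 := orbit_add_of_mul_le (i := i + 1) (t := m) hα0 (ρ := ρ) (by rw [h1]; linarith)
    rw [h1] at h4
    exact ⟨h4, by rw [h4]; linarith⟩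
  refine mem_APR_of_mem_AR hn1 ⟨i, i + 1 + s + 1, ?_, ?_, by omega, ?_, ?_⟩
  · rw [mem_abOcc_iff_of_lt hα hρ hn]
    linarith
  · obtain ⟨h3, h4⟩ := h2 s le_rfl
    rw [mem_abOcc_iff_of_lt hα hρ hn, orbit_succ_of_le (by linarith), h3]
    linarith
  · intro m hm hm'
    obtain ⟨k, rfl⟩ := Nat.exists_eq_add_of_le (show i + 1 ≤ m from hm)
    rw [mem_abOcc_iff_of_lt hα hρ hn, not_lt]
    exact (h2 k (by omega)).2.le
  · rw [show i + 1 + s + 1 - i = s + 1 + 1 by omega, seg_succ', sturmian_of_lt hi',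
      seg_eq_replicate _ _ _ fun m hm =>
        sturmian_of_le (by linarith [(h2 m (by omega)).2])]

lemma replicate_append_false_mem_APR (hα : α ∈ Ioo (0 : ℝ) 1) (hρ : ρ ∈ Ioo (0 : ℝ) 1)
    (hirr : Irrational α) (hρα : ρ < 1 - α) {s : ℕ} (hs : s * α < ρ) :
    List.replicate (s + 1) true ++ [false] ∈ APR (sturmian α ρ) := by
  obtain ⟨hα0, hα1⟩ := id hα
  have hsα : 0 ≤ s * α := by positivity
  obtain ⟨n, hn1, hn, hn'⟩ := exists_fract_mem hirr
    (a := s * α) (b := min ρ ((s + 1) * α)) hsα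
    (lt_min hs (by linarith)) (min_le_of_left_le hρ.2.le)
  obtain ⟨hn', hn2⟩ := lt_min_iff.1 hn'
  obtain ⟨i, hi, hi'⟩ := exists_orbit_mem hα hρ hirr
    (a := (s + 1) * α) (b := Int.fract (n * α) + α) (by linarith) (by linarith) (by linarith)
  have h2 : ∀ m ≤ s + 1, (twoIE α)^[i + m] ρ = (twoIE α)^[i] ρ - m * α := by
    intro m hms
    have h3 : (m : ℝ) * α ≤ (s + 1 : ℕ) * α := by gcongr
    push_cast at h3
    exact orbit_add_of_mul_le hα0 (by linarith)
  have h3 := h2 (s + 1) le_rfl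
  push_cast at h3
  have h4 : (twoIE α)^[i + (s + 1)] ρ < α := by linarith
  refine mem_APR_of_mem_AR hn1 ⟨i, i + (s + 1) + 1, ?_, ?_, by omega, ?_, ?_⟩
  · rw [mem_abOcc_iff_of_le hα hρ hn'.le]
    linarith
  · rw [mem_abOcc_iff_of_le hα hρ hn'.le, orbit_succ_of_lt h4]
    linarith
  · intro m hm hm'
    obtain ⟨k, rfl⟩ := Nat.exists_eq_add_of_lt hm
    rw [mem_abOcc_iff_of_le hα hρ hn'.le, not_le, add_assoc, h2 (k + 1) (by omega)]
    have : 0 ≤ (k : ℝ) * α := by positivity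
    push_cast
    linarith
  · rw [show i + (s + 1) + 1 - i = s + 1 + 1 by omega, seg_succ, sturmian_of_lt h4,
      seg_eq_replicate _ _ _ fun m hm => sturmian_of_le ?_]
    have h5 : (m : ℝ) * α ≤ s * α := by
      gcongr
      omega
    rw [h2 m (by omega)]
    linarith

lemma APR_eq (hα : α ∈ Ioo (0 : ℝ) 1) (hρ : ρ ∈ Ioo (0 : ℝ) 1) (hirr : Irrational α)
    (hρint : ρ ∈ Ioo α (1 - α)) :
    APR (sturmian α ρ) =
      ((({[true], [false]} : Finset (List Bool)) ∪
        (Finset.range ⌈(1 - ρ) / α⌉₊).image (fun s => false :: List.replicate (s + 1) true) ∪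
        (Finset.range ⌈ρ / α⌉₊).image (fun s => List.replicate (s + 1) true ++ [false]) :
          Finset (List Bool)) : Set (List Bool)) := by
  ext v
  simp only [Finset.mem_coe, Finset.mem_union, Finset.mem_insert, Finset.mem_singleton,
    Finset.mem_image, Finset.mem_range, Nat.lt_ceil, lt_div_iff₀ hα.1]
  constructor
  · intro hv
    obtain ⟨n, -, hn⟩ := mem_iUnion₂.1 hv
    rcases lt_or_ge ρ (Int.fract (n * α)) with h | h
    · rcases mem_of_mem_AR_of_lt hα hρ hρint.1 h hn with h | h | ⟨s, hs, rfl⟩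
      · simp [h]
      · simp [h]
      · exact Or.inl (Or.inr ⟨s, hs, rfl⟩)
    · rcases mem_of_mem_AR_of_le hα hρ hρint.2 h hn with h | h | ⟨s, hs, rfl⟩
      · simp [h]
      · simp [h]
      · exact Or.inr ⟨s, hs, rfl⟩
  · rintro (((rfl | rfl) | ⟨s, hs, rfl⟩) | ⟨s, hs, rfl⟩)
    · exact true_mem_APR hα hρ hirr hρint.1
    · exact false_mem_APR hα hρ hirr hρint.1 hρint.2
    · exact false_cons_replicate_mem_APR hα hρ hirr hρint.1 hs
    · exact replicate_append_false_mem_APR hα hρ hirr hρint.2 hs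

end AbelianReturns

lemma card_return_words (J K : ℕ) :
    (({[true], [false]} : Finset (List Bool)) ∪
      (Finset.range J).image (fun s => false :: List.replicate (s + 1) true) ∪
      (Finset.range K).image (fun s => List.replicate (s + 1) true ++ [false])).card =
        2 + J + K := by
  rw [Finset.card_union_of_disjoint, Finset.card_union_of_disjoint,
    Finset.card_image_of_injective, Finset.card_image_of_injective, Finset.card_range,
    Finset.card_range]
  · rfl
  · intro a b h
    simpa using congrArg List.length h
  · intro a b h
    simpa using congrArg List.length h
  · simp [Finset.disjoint_left, List.replicate_succ]
  · simp only [Finset.disjoint_left, Finset.mem_union, Finset.mem_insert, Finset.mem_singleton,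
      Finset.mem_image, Finset.mem_range]
    rintro v ((rfl | rfl) | ⟨s, -, rfl⟩) ⟨t, -, h⟩ <;>
      simp [List.replicate_succ] at h

lemma ceil_add_ceil_eq {α ρ : ℝ} (hα : 0 < α) (hirr : Irrational α) (hρ : ρ ∈ Ioo (0 : ℝ) 1) :
    ⌈(1 - ρ) / α⌉₊ + ⌈ρ / α⌉₊ = ⌊α⁻¹⌋₊ + 1 ∨ ⌈(1 - ρ) / α⌉₊ + ⌈ρ / α⌉₊ = ⌊α⁻¹⌋₊ + 2 := by
  have h1 : (0 : ℝ) ≤ (1 - ρ) / α := div_nonneg (by linarith [hρ.2]) hα.le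
  have h2 : (0 : ℝ) ≤ ρ / α := div_nonneg hρ.1.le hα.le
  have hsum : (1 - ρ) / α + ρ / α = α⁻¹ := by field_simp; ring
  have h3 := Nat.ceil_lt_add_one h1
  have h4 := Nat.ceil_lt_add_one h2
  have h5 := Nat.le_ceil ((1 - ρ) / α)
  have h6 := Nat.le_ceil (ρ / α)
  have h7 := Nat.lt_floor_add_one α⁻¹
  have h8 : (⌊α⁻¹⌋₊ : ℝ) < α⁻¹ :=
    (Nat.floor_le (inv_nonneg.2 hα.le)).lt_of_ne (hirr.inv.ne_nat _).symm
  generalize ⌈(1 - ρ) / α⌉₊ = J at *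
  generalize ⌈ρ / α⌉₊ = K at *
  generalize ⌊α⁻¹⌋₊ = N at *
  have h9 : (N : ℝ) < (J + K : ℕ) := by push_cast; linarith
  have h10 : ((J + K : ℕ) : ℝ) < (N + 3 : ℕ) := by push_cast; linarith
  rw [Nat.cast_lt] at h9 h10
  omega

/-- if `a₁ ≥ 2` and `ρ ∈ (α, 1-α)`, then
`#APR_u ∈ {a₁ + 3, a₁ + 4}`. -/
theorem card_APR_middle (α ρ : ℝ) (hα : α ∈ Set.Ioo (0:ℝ) 1)
    (hirr : Irrational α) (hρ : ρ ∈ Set.Ioo (0:ℝ) 1)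
    (ha1 : 2 ≤ cfa α 1) (hρint : ρ ∈ Set.Ioo α (1 - α)) :
    (APR (sturmian α ρ)).ncard = cfa α 1 + 3 ∨
      (APR (sturmian α ρ)).ncard = cfa α 1 + 4 := by
  rw [APR_eq hα hρ hirr hρint, Set.ncard_coe_finset, card_return_words,
    show cfa α 1 = ⌊α⁻¹⌋₊ from rfl]
  have := ceil_add_ceil_eq hα.1 hirr hρ
  omega
end
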